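/- Fix k ∈ ℕ and M ≥ 2. Let a₁ < b₁, a₂ < b₂, Δx := b₁ − a₁, Δy := b₂ − a₂, and K := [a₁,b₁] × [a₂,b₂]. Let a₁ = x_1 < ⋯ < x_M = b₁ with weights ωx_1, …, ωx_M, all positive, with ωx_1 = ωx_M, such that Σ_m ωx_m q(x_m) = (1/Δx) ∫_{a₁}^{b₁} q for every real polynomial q of degree at most k; and let a₂ = y_1 < ⋯ < y_M = b₂ with weights ωy_1, …, ωy_M, all positive, with ωy_1 = ωy_M, exact in the same sense on [a₂,b₂]. Let c(x,y) be a real polynomial of degree at most k in each variable with c(x,y) > 0 for all (x,y) ∈ K. Let uE_n, uW_n ≥ 0 (n = 1,…,M) and uN_m, uS_m ≥ 0 (m = 1,…,M) be exterior nodal trace values, and FE_n, FW_n, FN_m, FS_m ∈ ℝ nodal flux values. Define the interior nodal traces vE_n := c(b₁, y_n), vW_n := c(a₁, y_n), vN_m := c(x_m, b₂), vS_m := c(x_m, a₂), and, at each edge node, with {c} := (u+v)/2 and β̃ := |F|/{c}, the modified flux terms G_E,n := {c}·(FE_n + (β̃/2)(uE_n − vE_n)), G_W,n := {c}·(FW_n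 + (β̃/2)(vW_n − uW_n)), G_N,m := {c}·(FN_m + (β̃/2)(uN_m − vN_m)), G_S,m := {c}·(FS_m + (β̃/2)(vS_m − uS_m)). Let Δt ≥ 0 satisfy the strict CFL conditions 2Δt·|FE_n| < ωx_1·Δx and 2Δt·|FW_n| < ωx_1·Δx for all n, and 2Δt·|FN_m| < ωy_1·Δy and 2Δt·|FS_m| < ωy_1·Δy for all m. Then the updated cell average c̄' := (1/(ΔxΔy)) ∫_K c + Δt·[ (1/Δx) Σ_{n=1}^M ωy_n·(G_E,n − G_W,n) + (1/Δy) Σ_{m=1}^M ωx_m·(G_N,m − G_S,m) ] is strictly positive. -/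

import Mathlib

theorem aux_flux (u v F : ℝ) (hu : 0 ≤ u) (hv : 0 < v) :
    -(|F| * v) ≤ ((u + v) / 2) * (F + ((|F| / ((u + v) / 2)) / 2) * (u - v)) := by
  have h : (u + v) / 2 ≠ 0 := by positivity
  have e : ((u + v) / 2) * (F + ((|F| / ((u + v) / 2)) / 2) * (u - v))
      = (u + v) / 2 * F + |F| / 2 * (u - v) := by
    field_simp
  rw [e]
  have h1 := neg_abs_le F
  nlinarith [mul_nonneg hu (by linarith : 0 ≤ F + |F|), mul_nonneg hv.le (by linarith : 0 ≤ F + |F|)]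

theorem aux_row (M : ℕ) (hM : 2 ≤ M) (a b : ℝ) (hab : a < b) (x ω : ℕ → ℝ)
    (hx1 : x 1 = a) (hxM : x M = b)
    (hω : ∀ m ∈ Finset.Icc 1 M, 0 < ω m) (hsym : ω 1 = ω M)
    (f : ℝ → ℝ) (hf : ∀ m ∈ Finset.Icc 1 M, 0 < f (x m))
    (u w F G P Q Δt : ℝ) (hu : 0 ≤ u) (hw : 0 ≤ w) (hΔt : 0 ≤ Δt)
    (hP : P = ((u + f b) / 2) * (F + ((|F| / ((u + f b) / 2)) / 2) * (u - f b)))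
    (hQ : Q = ((w + f a) / 2) * (G + ((|G| / ((w + f a) / 2)) / 2) * (f a - w)))
    (hF : 2 * Δt * |F| < ω 1 * (b - a)) (hG : 2 * Δt * |G| < ω 1 * (b - a)) :
    0 < (∑ m ∈ Finset.Icc 1 M, ω m * f (x m)) / 2 + Δt * (1 / (b - a)) * (P - Q) := by
  have m1 : 1 ∈ Finset.Icc 1 M := by simp; omega
  have mM : M ∈ Finset.Icc 1 M := by simp; omega
  have hsum : ω 1 * f a + ω 1 * f b ≤ ∑ m ∈ Finset.Icc 1 M, ω m * f (x m) := by
    have := Finset.sum_le_sum_of_subset_of_nonneg (s := {1, M}) (t := Finset.Icc 1 M)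
      (f := fun m => ω m * f (x m)) (by intro i; simp; omega)
      (fun i hi _ => (mul_pos (hω i hi) (hf i hi)).le)
    rw [Finset.sum_pair (by omega), hx1, hxM, ← hsym] at this
    exact this
  have fa : 0 < f a := hx1 ▸ hf 1 m1
  have fb : 0 < f b := hxM ▸ hf M mM
  have e1 := aux_flux u (f b) F hu fb
  have e2 := aux_flux w (f a) (-G) hw fa
  rw [← hP] at e1
  have e3 : ((w + f a) / 2) * (-G + ((|-G| / ((w + f a) / 2)) / 2) * (w - f a)) = -Q := by
    rw [hQ, abs_neg]; ring
  rw [e3, abs_neg] at e2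
  have hd : 0 < b - a := by linarith
  have key : 0 < (b - a) * ((ω 1 * f a + ω 1 * f b) / 2) + Δt * (P - Q) := by
    have := mul_le_mul_of_nonneg_left e1 hΔt
    have := mul_le_mul_of_nonneg_left e2 hΔt
    have := mul_lt_mul_of_pos_right hF fb
    have := mul_lt_mul_of_pos_right hG fa
    linarith
  have : 0 < (ω 1 * f a + ω 1 * f b) / 2 + Δt * (1 / (b - a)) * (P - Q) := by
    have h := div_pos key hd
    have e : ((b - a) * ((ω 1 * f a + ω 1 * f b) / 2) + Δt * (P - Q)) / (b - a)
        = (ω 1 * f a + ω 1 * f b) / 2 + Δt * (1 / (b - a)) * (P - Q) := by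
      rw [add_div, mul_div_cancel_left₀ _ hd.ne']
      ring
    rw [e] at h
    exact h
  linarith

theorem aux_poly1 (c : MvPolynomial (Fin 2) ℝ) (s : ℝ) :
    ∃ q : Polynomial ℝ, q.natDegree ≤ c.degreeOf 1 ∧
      ∀ t, q.eval t = MvPolynomial.eval ![s, t] c := by
  refine ⟨∑ d ∈ c.support, Polynomial.C (c.coeff d * s ^ d 0) * Polynomial.X ^ d 1, ?_, ?_⟩
  · refine Polynomial.natDegree_sum_le_of_forall_le _ _ fun d hd => ?_
    exact (Polynomial.natDegree_C_mul_X_pow_le _ _).trans (MvPolynomial.monomial_le_degreeOf 1 hd)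
  · intro t
    rw [MvPolynomial.eval_eq', Polynomial.eval_finsetSum]
    refine Finset.sum_congr rfl fun d _ => ?_
    simp [Fin.prod_univ_two]; ring

theorem aux_poly0 (c : MvPolynomial (Fin 2) ℝ) (t : ℝ) :
    ∃ q : Polynomial ℝ, q.natDegree ≤ c.degreeOf 0 ∧
      ∀ s, q.eval s = MvPolynomial.eval ![s, t] c := by
  refine ⟨∑ d ∈ c.support, Polynomial.C (c.coeff d * t ^ d 1) * Polynomial.X ^ d 0, ?_, ?_⟩
  · refine Polynomial.natDegree_sum_le_of_forall_le _ _ fun d hd => ?_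
    exact (Polynomial.natDegree_C_mul_X_pow_le _ _).trans (MvPolynomial.monomial_le_degreeOf 0 hd)
  · intro s
    rw [MvPolynomial.eval_eq', Polynomial.eval_finsetSum]
    refine Finset.sum_congr rfl fun d _ => ?_
    simp [Fin.prod_univ_two]; ring


/-- Theorem 4.1 of the paper in dimension `d = 2`, for a single rectangular cell:
positivity of the updated cell average for the positivity-preserving DDG scheme
on rectangular meshes, with edge integrals evaluated by the `M`-point
Gauss–Lobatto rule and a strict CFL condition `2Δt|F| < ω₁Δx`. -/
theorem positivity_cell_average_2D
    (k M : ℕ) (hM : 2 ≤ M)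
    (a₁ b₁ a₂ b₂ : ℝ) (h1 : a₁ < b₁) (h2 : a₂ < b₂)
    (x ωx y ωy : ℕ → ℝ)
    (hx1 : x 1 = a₁) (hxM : x M = b₁) (hxmono : StrictMonoOn x (Set.Icc 1 M))
    (hωxpos : ∀ m ∈ Finset.Icc 1 M, 0 < ωx m) (hωxsym : ωx 1 = ωx M)
    (hy1 : y 1 = a₂) (hyM : y M = b₂) (hymono : StrictMonoOn y (Set.Icc 1 M))
    (hωypos : ∀ n ∈ Finset.Icc 1 M, 0 < ωy n) (hωysym : ωy 1 = ωy M)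
    (hxexact : ∀ q : Polynomial ℝ, q.natDegree ≤ k →
      ∑ m ∈ Finset.Icc 1 M, ωx m * q.eval (x m)
        = (1 / (b₁ - a₁)) * ∫ t in a₁..b₁, q.eval t)
    (hyexact : ∀ q : Polynomial ℝ, q.natDegree ≤ k →
      ∑ n ∈ Finset.Icc 1 M, ωy n * q.eval (y n)
        = (1 / (b₂ - a₂)) * ∫ t in a₂..b₂, q.eval t)
    (c : MvPolynomial (Fin 2) ℝ)
    (hc0 : c.degreeOf 0 ≤ k) (hc1 : c.degreeOf 1 ≤ k)
    (hcpos : ∀ s ∈ Set.Icc a₁ b₁, ∀ t ∈ Set.Icc a₂ b₂,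
      0 < MvPolynomial.eval ![s, t] c)
    (uE uW uN uS : ℕ → ℝ)
    (huE : ∀ n ∈ Finset.Icc 1 M, 0 ≤ uE n)
    (huW : ∀ n ∈ Finset.Icc 1 M, 0 ≤ uW n)
    (huN : ∀ m ∈ Finset.Icc 1 M, 0 ≤ uN m)
    (huS : ∀ m ∈ Finset.Icc 1 M, 0 ≤ uS m)
    (FE FW FN FS : ℕ → ℝ)
    (GE GW GN GS : ℕ → ℝ)
    (hGE : ∀ n ∈ Finset.Icc 1 M,
      GE n = ((uE n + MvPolynomial.eval ![b₁, y n] c) / 2) *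
        (FE n + ((|FE n| / ((uE n + MvPolynomial.eval ![b₁, y n] c) / 2)) / 2) *
          (uE n - MvPolynomial.eval ![b₁, y n] c)))
    (hGW : ∀ n ∈ Finset.Icc 1 M,
      GW n = ((uW n + MvPolynomial.eval ![a₁, y n] c) / 2) *
        (FW n + ((|FW n| / ((uW n + MvPolynomial.eval ![a₁, y n] c) / 2)) / 2) *
          (MvPolynomial.eval ![a₁, y n] c - uW n)))
    (hGN : ∀ m ∈ Finset.Icc 1 M,
      GN m = ((uN m + MvPolynomial.eval ![x m, b₂] c) / 2) *
        (FN m + ((|FN m| / ((uN m + MvPolynomial.eval ![x m, b₂] c) / 2)) / 2) *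
          (uN m - MvPolynomial.eval ![x m, b₂] c)))
    (hGS : ∀ m ∈ Finset.Icc 1 M,
      GS m = ((uS m + MvPolynomial.eval ![x m, a₂] c) / 2) *
        (FS m + ((|FS m| / ((uS m + MvPolynomial.eval ![x m, a₂] c) / 2)) / 2) *
          (MvPolynomial.eval ![x m, a₂] c - uS m)))
    (Δt : ℝ) (hΔt : 0 ≤ Δt)
    (hCFL_E : ∀ n ∈ Finset.Icc 1 M, 2 * Δt * |FE n| < ωx 1 * (b₁ - a₁))
    (hCFL_W : ∀ n ∈ Finset.Icc 1 M, 2 * Δt * |FW n| < ωx 1 * (b₁ - a₁))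
    (hCFL_N : ∀ m ∈ Finset.Icc 1 M, 2 * Δt * |FN m| < ωy 1 * (b₂ - a₂))
    (hCFL_S : ∀ m ∈ Finset.Icc 1 M, 2 * Δt * |FS m| < ωy 1 * (b₂ - a₂)) :
    0 < (1 / ((b₁ - a₁) * (b₂ - a₂))) *
          (∫ s in a₁..b₁, ∫ t in a₂..b₂, MvPolynomial.eval ![s, t] c)
        + Δt * ((1 / (b₁ - a₁)) * ∑ n ∈ Finset.Icc 1 M, ωy n * (GE n - GW n)
              + (1 / (b₂ - a₂)) * ∑ m ∈ Finset.Icc 1 M, ωx m * (GN m - GS m)) := by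
  have hd1 : 0 < b₁ - a₁ := by linarith
  have hd2 : 0 < b₂ - a₂ := by linarith
  have hxm : ∀ m ∈ Finset.Icc 1 M, x m ∈ Set.Icc a₁ b₁ := by
    intro m hm
    rw [Finset.mem_Icc] at hm
    rw [← hx1, ← hxM]
    exact ⟨hxmono.monotoneOn ⟨le_rfl, by omega⟩ hm hm.1,
      hxmono.monotoneOn hm ⟨by omega, le_rfl⟩ hm.2⟩
  have hym : ∀ m ∈ Finset.Icc 1 M, y m ∈ Set.Icc a₂ b₂ := by
    intro m hm
    rw [Finset.mem_Icc] at hm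
    rw [← hy1, ← hyM]
    exact ⟨hymono.monotoneOn ⟨le_rfl, by omega⟩ hm hm.1,
      hymono.monotoneOn hm ⟨by omega, le_rfl⟩ hm.2⟩
  have ey : ∀ s, ∫ t in a₂..b₂, MvPolynomial.eval ![s, t] c
      = (b₂ - a₂) * ∑ n ∈ Finset.Icc 1 M, ωy n * MvPolynomial.eval ![s, y n] c := by
    intro s
    obtain ⟨q, hq, he⟩ := aux_poly1 c s
    have := hyexact q (hq.trans hc1)
    simp only [he] at this
    rw [this]; field_simp
  have ex : ∀ t, ∫ s in a₁..b₁, MvPolynomial.eval ![s, t] c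
      = (b₁ - a₁) * ∑ m ∈ Finset.Icc 1 M, ωx m * MvPolynomial.eval ![x m, t] c := by
    intro t
    obtain ⟨q, hq, he⟩ := aux_poly0 c t
    have := hxexact q (hq.trans hc0)
    simp only [he] at this
    rw [this]; field_simp
  have hint : ∀ t, IntervalIntegrable (fun s => MvPolynomial.eval ![s, t] c)
      MeasureTheory.volume a₁ b₁ := by
    intro t
    obtain ⟨q, hq, he⟩ := aux_poly0 c t
    simp only [← he]
    exact q.continuous.intervalIntegrable _ _
  have eA : (1 / ((b₁ - a₁) * (b₂ - a₂))) *
      (∫ s in a₁..b₁, ∫ t in a₂..b₂, MvPolynomial.eval ![s, t] c)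
      = ∑ n ∈ Finset.Icc 1 M, ωy n * ∑ m ∈ Finset.Icc 1 M,
          ωx m * MvPolynomial.eval ![x m, y n] c := by
    simp only [ey]
    rw [intervalIntegral.integral_const_mul,
      intervalIntegral.integral_finsetSum (fun n _ => (hint (y n)).const_mul (ωy n))]
    simp only [intervalIntegral.integral_const_mul, ex]
    rw [Finset.mul_sum, Finset.mul_sum]
    refine Finset.sum_congr rfl fun n _ => ?_
    field_simp
  have eB : ∑ n ∈ Finset.Icc 1 M, ωy n * ∑ m ∈ Finset.Icc 1 M,
          ωx m * MvPolynomial.eval ![x m, y n] c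
      = ∑ m ∈ Finset.Icc 1 M, ωx m * ∑ n ∈ Finset.Icc 1 M,
          ωy n * MvPolynomial.eval ![x m, y n] c := by
    simp only [Finset.mul_sum]
    rw [Finset.sum_comm]
    refine Finset.sum_congr rfl fun m _ => Finset.sum_congr rfl fun n _ => ?_
    ring
  have hne : (Finset.Icc 1 M).Nonempty := ⟨1, by simp; omega⟩
  have r1 : 0 < ∑ n ∈ Finset.Icc 1 M, ωy n * ((∑ m ∈ Finset.Icc 1 M,
      ωx m * MvPolynomial.eval ![x m, y n] c) / 2
        + Δt * (1 / (b₁ - a₁)) * (GE n - GW n)) := by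
    refine Finset.sum_pos (fun n hn => mul_pos (hωypos n hn) ?_) hne
    exact aux_row M hM a₁ b₁ h1 x ωx hx1 hxM hωxpos hωxsym
      (fun s => MvPolynomial.eval ![s, y n] c)
      (fun m hm => hcpos _ (hxm m hm) _ (hym n hn)) (uE n) (uW n) (FE n) (FW n) _ _ Δt
      (huE n hn) (huW n hn) hΔt (hGE n hn) (hGW n hn) (hCFL_E n hn) (hCFL_W n hn)
  have r2 : 0 < ∑ m ∈ Finset.Icc 1 M, ωx m * ((∑ n ∈ Finset.Icc 1 M,
      ωy n * MvPolynomial.eval ![x m, y n] c) / 2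
        + Δt * (1 / (b₂ - a₂)) * (GN m - GS m)) := by
    refine Finset.sum_pos (fun m hm => mul_pos (hωxpos m hm) ?_) hne
    exact aux_row M hM a₂ b₂ h2 y ωy hy1 hyM hωypos hωysym
      (fun t => MvPolynomial.eval ![x m, t] c)
      (fun n hn => hcpos _ (hxm m hm) _ (hym n hn)) (uN m) (uS m) (FN m) (FS m) _ _ Δt
      (huN m hm) (huS m hm) hΔt (hGN m hm) (hGS m hm) (hCFL_N m hm) (hCFL_S m hm)
  have split : ∀ (w A B : ℕ → ℝ) (d : ℝ), ∑ n ∈ Finset.Icc 1 M, w n * (A n / 2 + d * B n)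
      = (∑ n ∈ Finset.Icc 1 M, w n * A n) / 2 + d * ∑ n ∈ Finset.Icc 1 M, w n * B n := by
    intro w A B d
    rw [Finset.sum_div, Finset.mul_sum, ← Finset.sum_add_distrib]
    refine Finset.sum_congr rfl fun n _ => ?_
    ring
  rw [split] at r1 r2
  rw [← eB] at r2
  rw [eA]
  linarith
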